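/- arXiv:1312.2445 — 5 statements merged into one kernel-verified Lean document; each statement's English description precedes it below -/
import Mathlib

section
/- Let Ω be an open subset of ℝⁿ, let F : Ω → ℝⁿ be differentiable, and let p ∈ Ω satisfy det JF(p) ≠ 0. Suppose the real function of n² variables (ξᵢⱼ)₁≤i,j≤n ↦ det((∂Fᵢ/∂xⱼ)(ξᵢⱼ)), where each ξᵢⱼ runs over Ω, is continuous at the point with all ξᵢⱼ = p. Then there exists r > 0 such that the restriction of F to the open ball B(p; r) is injective. -/
/-- If `F : Ω → ℝⁿ` is differentiable, `det JF(p) ≠ 0`, and the mixed-points determinant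
`(ξᵢⱼ) ↦ det((∂Fᵢ/∂xⱼ)(ξᵢⱼ))` (each `ξᵢⱼ` running over `Ω`) is continuous at the point
with all `ξᵢⱼ = p`, then `F` is injective on some open ball `B(p; r)`. -/
theorem stmt_2 (n : ℕ) (Ω : Set (EuclideanSpace ℝ (Fin n))) (hΩ : IsOpen Ω)
    (F : EuclideanSpace ℝ (Fin n) → EuclideanSpace ℝ (Fin n))
    (hF : ∀ x ∈ Ω, DifferentiableAt ℝ F x)
    (p : EuclideanSpace ℝ (Fin n)) (hp : p ∈ Ω)
    (hdet : (Matrix.of fun (i j : Fin n) =>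
        fderiv ℝ F p (EuclideanSpace.single j 1) i).det ≠ 0)
    (hcont : ContinuousWithinAt
      (fun ξ : Fin n → Fin n → EuclideanSpace ℝ (Fin n) =>
        (Matrix.of fun (i j : Fin n) =>
          fderiv ℝ F (ξ i j) (EuclideanSpace.single j 1) i).det)
      {ξ | ∀ i j, ξ i j ∈ Ω} (fun _ _ => p)) :
    ∃ r > 0, Metric.ball p r ⊆ Ω ∧ Set.InjOn F (Metric.ball p r) := by
  have hne := hcont.eventually (isOpen_ne.mem_nhds hdet)
  obtain ⟨ε, hε, hball⟩ := Metric.mem_nhdsWithin_iff.1 hne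
  obtain ⟨δ, hδ, hδΩ⟩ := Metric.isOpen_iff.1 hΩ p hp
  have hsub : Metric.ball p (min ε δ) ⊆ Ω :=
    (Metric.ball_subset_ball (min_le_right _ _)).trans hδΩ
  refine ⟨min ε δ, lt_min hε hδ, hsub, ?_⟩
  intro a ha b hb hab
  by_contra hne'
  have key : ∀ i : Fin n, ∃ z ∈ Metric.ball p (min ε δ), fderiv ℝ F z (b - a) i = 0 := by
    intro i
    have hd : ∀ x ∈ Metric.ball p (min ε δ), HasFDerivWithinAt (fun x => F x i)
        ((EuclideanSpace.proj i : EuclideanSpace ℝ (Fin n) →L[ℝ] ℝ).comp (fderiv ℝ F x))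
        (Metric.ball p (min ε δ)) x := by
      intro x hx
      exact ((EuclideanSpace.proj i : EuclideanSpace ℝ (Fin n) →L[ℝ] ℝ).hasFDerivAt.comp x
        (hF x (hsub hx)).hasFDerivAt).hasFDerivWithinAt
    obtain ⟨z, hz, h⟩ := domain_mvt hd (convex_ball _ _) ha hb
    refine ⟨z, (convex_ball _ _).segment_subset ha hb hz, ?_⟩
    simp only [hab, sub_self] at h
    exact h.symm
  choose z hz hz0 using key
  have hm : (fun i _ => z i : Fin n → Fin n → EuclideanSpace ℝ (Fin n)) ∈
      Metric.ball (fun _ _ => p) ε ∩ {ξ | ∀ i j, ξ i j ∈ Ω} := by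
    refine ⟨?_, fun i j => hsub (hz i)⟩
    rw [Metric.mem_ball, dist_pi_lt_iff hε]
    intro i
    rw [dist_pi_lt_iff hε]
    intro j
    exact lt_of_lt_of_le (Metric.mem_ball.1 (hz i)) (min_le_left _ _)
  have hdet' := hball hm
  apply hdet'
  rw [← Matrix.exists_mulVec_eq_zero_iff]
  refine ⟨fun j => (b - a) j, ?_, ?_⟩
  · intro h0
    apply hne'
    ext j
    have := congrFun h0 j
    simp at this
    linarith
  · ext i
    have hs : b - a = ∑ j, (b - a) j • (EuclideanSpace.single j (1 : ℝ)) := by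
      ext k
      simp [Pi.single_apply]
    have h := hz0 i
    rw [hs, map_sum] at h
    simp only [map_smul] at h
    simp only [Matrix.mulVec, dotProduct, Matrix.of_apply, Pi.zero_apply]
    rw [← h]
    simp [mul_comm]
end

section
/- Let Ω be an open subset of ℝⁿ × ℝ, let F : Ω → ℝ be differentiable with ∂F/∂y nowhere vanishing on Ω, and let (a, b) ∈ Ω satisfy F(a, b) = 0. Then there exist an open set X ⊆ ℝⁿ containing a and an open set Y ⊆ ℝ containing b, with X × Y ⊆ Ω, and a unique function g : X → Y such that F(x, g(x)) = 0 for all x in X; moreover g(a) = b. -/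
/-- Implicit function theorem for a single scalar equation (existence and uniqueness):
if `F : Ω → ℝ` is differentiable on the open set `Ω ⊆ ℝⁿ × ℝ`, with `∂F/∂y` nowhere
vanishing on `Ω`, and `F(a,b) = 0`, then there is an open set `X × Y ⊆ Ω` containing
`(a,b)` and a unique function `g : X → Y` with `F(x, g x) = 0` on `X`; moreover `g a = b`. -/
theorem stmt_5 (n : ℕ) (Ω : Set (EuclideanSpace ℝ (Fin n) × ℝ)) (hΩ : IsOpen Ω)
    (F : EuclideanSpace ℝ (Fin n) × ℝ → ℝ)
    (hF : ∀ p ∈ Ω, DifferentiableAt ℝ F p)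
    (hFy : ∀ p ∈ Ω, fderiv ℝ F p (0, 1) ≠ 0)
    (a : EuclideanSpace ℝ (Fin n)) (b : ℝ)
    (hab : (a, b) ∈ Ω) (hFab : F (a, b) = 0) :
    ∃ (X : Set (EuclideanSpace ℝ (Fin n))) (Y : Set ℝ),
      IsOpen X ∧ IsOpen Y ∧ a ∈ X ∧ b ∈ Y ∧ X ×ˢ Y ⊆ Ω ∧
      ∃ g : EuclideanSpace ℝ (Fin n) → ℝ,
        (∀ x ∈ X, g x ∈ Y) ∧ (∀ x ∈ X, F (x, g x) = 0) ∧ g a = b ∧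
        ∀ h : EuclideanSpace ℝ (Fin n) → ℝ,
          (∀ x ∈ X, h x ∈ Y) → (∀ x ∈ X, F (x, h x) = 0) → Set.EqOn h g X := by
  obtain ⟨r, hr, hball⟩ := Metric.isOpen_iff.1 hΩ (a, b) hab
  have hmem : ∀ x ∈ Metric.ball a r, ∀ y ∈ Metric.ball b r, (x, y) ∈ Ω := by
    intro x hx y hy
    apply hball
    rw [← ball_prod_same]
    exact ⟨hx, hy⟩
  have hder : ∀ x ∈ Metric.ball a r, ∀ y ∈ Metric.ball b r,
      HasDerivAt (fun y => F (x, y)) (fderiv ℝ F (x, y) (0, 1)) y := by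
    intro x hx y hy
    have h1 := (hF _ (hmem x hx y hy)).hasFDerivAt
    have h2 : HasDerivAt (fun y : ℝ => (x, y)) (0, 1) y :=
      (hasDerivAt_const y x).prodMk (hasDerivAt_id y)
    exact h1.comp_hasDerivAt y h2
  have hlt : ∀ x ∈ Metric.ball a r, ∀ y ∈ Metric.ball b r, ∀ z ∈ Metric.ball b r,
      y < z → F (x, y) ≠ F (x, z) := by
    intro x hx y hy z hz hyz heq
    have hsub : Set.Icc y z ⊆ Metric.ball b r := by
      rw [Real.ball_eq_Ioo] at *
      exact fun w hw => ⟨lt_of_lt_of_le hy.1 hw.1, lt_of_le_of_lt hw.2 hz.2⟩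
    obtain ⟨c, hc, hc0⟩ := exists_hasDerivAt_eq_zero (f := fun y => F (x, y))
      (f' := fun y => fderiv ℝ F (x, y) (0, 1)) hyz
      (fun w hw => (hder x hx w (hsub hw)).continuousAt.continuousWithinAt) heq
      (fun w hw => hder x hx w (hsub (Set.Ioo_subset_Icc_self hw)))
    exact hFy _ (hmem x hx c (hsub (Set.Ioo_subset_Icc_self hc))) hc0
  have hinj : ∀ x ∈ Metric.ball a r, Set.InjOn (fun y => F (x, y)) (Metric.ball b r) := by
    intro x hx y hy z hz heq
    rcases lt_trichotomy y z with h | h | h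
    · exact absurd heq (hlt x hx y hy z hz h)
    · exact h
    · exact absurd heq.symm (hlt x hx z hz y hy h)
  set s := r / 2 with hs
  have hs0 : 0 < s := by positivity
  have hIcc : Set.Icc (b - s) (b + s) ⊆ Metric.ball b r := by
    rw [Real.ball_eq_Ioo]
    exact fun w hw => ⟨by linarith [hw.1], by linarith [hw.2]⟩
  have hm : b - s ∈ Set.Icc (b - s) (b + s) := ⟨le_rfl, by linarith⟩
  have hp : b + s ∈ Set.Icc (b - s) (b + s) := ⟨by linarith, le_rfl⟩
  have hb : b ∈ Set.Icc (b - s) (b + s) := ⟨by linarith, by linarith⟩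
  have ha : a ∈ Metric.ball a r := Metric.mem_ball_self hr
  have hcont : ∀ x ∈ Metric.ball a r,
      ContinuousOn (fun y => F (x, y)) (Set.Icc (b - s) (b + s)) := fun x hx w hw =>
    (hder x hx w (hIcc hw)).continuousAt.continuousWithinAt
  have hprod : F (a, b - s) * F (a, b + s) < 0 := by
    rcases ContinuousOn.strictMonoOn_of_injOn_Icc' (by linarith : b - s ≤ b + s)
      (hcont a ha) ((hinj a ha).mono hIcc) with h | h
    · have h1 := h hm hb (by linarith)
      have h2 := h hb hp (by linarith)
      simp only [hFab] at h1 h2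
      exact mul_neg_of_neg_of_pos h1 h2
    · have h1 := h hm hb (by linarith)
      have h2 := h hb hp (by linarith)
      simp only [hFab] at h1 h2
      exact mul_neg_of_pos_of_neg h1 h2
  have hca : ∀ y ∈ Metric.ball b r, ContinuousAt (fun x => F (x, y)) a := by
    intro y hy
    have h1 : ContinuousAt F (a, y) := (hF _ (hmem a ha y hy)).continuousAt
    exact ContinuousAt.comp (f := fun x => (x, y)) (g := F) h1 (by fun_prop)
  have hev : ∀ᶠ x in nhds a, F (x, b - s) * F (x, b + s) < 0 :=
    ((hca _ (hIcc hm)).mul (hca _ (hIcc hp))).eventually_lt_const hprod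
  obtain ⟨X, hX, hXo, haX⟩ := eventually_nhds_iff.1
    (hev.and (Metric.isOpen_ball.eventually_mem ha))
  have hYb : Set.Ioo (b - s) (b + s) ⊆ Metric.ball b r := Set.Ioo_subset_Icc_self.trans hIcc
  have hex : ∀ x, x ∈ X → ∃ y, y ∈ Set.Ioo (b - s) (b + s) ∧ F (x, y) = 0 := by
    intro x hxX
    obtain ⟨hneg, hx⟩ := hX x hxX
    have hle : b - s ≤ b + s := by linarith
    have h0 : (0 : ℝ) ∈ Set.uIcc (F (x, b - s)) (F (x, b + s)) := by
      rw [Set.mem_uIcc]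
      rcases mul_neg_iff.1 hneg with h | h
      · exact Or.inr ⟨h.2.le, h.1.le⟩
      · exact Or.inl ⟨h.1.le, h.2.le⟩
    have hc := hcont x hx
    rw [← Set.uIcc_of_le hle] at hc
    obtain ⟨y, hy, hy0⟩ := intermediate_value_uIcc hc h0
    rw [Set.uIcc_of_le hle] at hy
    simp only at hy0
    refine ⟨y, ⟨lt_of_le_of_ne hy.1 ?_, lt_of_le_of_ne hy.2 ?_⟩, hy0⟩
    · rintro rfl
      simp [hy0] at hneg
    · rintro rfl
      simp [hy0] at hneg
  choose! g hgY hg0 using hex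
  have hbY : b ∈ Set.Ioo (b - s) (b + s) := ⟨by linarith, by linarith⟩
  refine ⟨X, Set.Ioo (b - s) (b + s), hXo, isOpen_Ioo, haX, hbY, ?_, g, hgY, hg0, ?_, ?_⟩
  · rintro ⟨x, y⟩ ⟨hx, hy⟩
    exact hmem x (hX x hx).2 y (hYb hy)
  · exact hinj a ha (hYb (hgY a haX)) (hYb hbY) ((hg0 a haX).trans hFab.symm)
  · intro h hhY hh0 x hx
    exact hinj x (hX x hx).2 (hYb (hhY x hx)) (hYb (hgY x hx))
      ((hh0 x hx).trans (hg0 x hx).symm)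
end

section
/- (Implicit Function Theorem, existence and uniqueness.) Let Ω be an open subset of ℝⁿ × ℝᵐ, let F : Ω → ℝᵐ be differentiable, and let (a, b) ∈ Ω satisfy F(a, b) = 0 and det (∂F/∂y)(a, b) ≠ 0, with the matrix-valued function (x, y) ↦ (∂F/∂y)(x, y) continuous at (a, b). Then there exist an open set X ⊆ ℝⁿ containing a and an open set Y ⊆ ℝᵐ containing b, with X × Y ⊆ Ω, and a unique function g : X → Y such that F(x, g(x)) = 0 for all x ∈ X; moreover g(a) = b. -/
/-- The Implicit Function Theorem (existence and uniqueness), with `∂F/∂y` continuous only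
at the base point: if `F : Ω → ℝᵐ` is differentiable on the open set `Ω ⊆ ℝⁿ × ℝᵐ`,
`F(a,b) = 0`, `det (∂F/∂y)(a,b) ≠ 0`, and `(x,y) ↦ (∂F/∂y)(x,y)` is continuous at `(a,b)`,
then there is an open set `X × Y ⊆ Ω` containing `(a,b)` and a unique function
`g : X → Y` with `F(x, g x) = 0` on `X`; moreover `g a = b`. -/
theorem stmt_9 (n m : ℕ)
    (Ω : Set (EuclideanSpace ℝ (Fin n) × EuclideanSpace ℝ (Fin m))) (hΩ : IsOpen Ω)
    (F : EuclideanSpace ℝ (Fin n) × EuclideanSpace ℝ (Fin m) → EuclideanSpace ℝ (Fin m))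
    (hF : ∀ p ∈ Ω, DifferentiableAt ℝ F p)
    (a : EuclideanSpace ℝ (Fin n)) (b : EuclideanSpace ℝ (Fin m))
    (hab : (a, b) ∈ Ω) (hFab : F (a, b) = 0)
    (hdet : (Matrix.of fun (i j : Fin m) =>
      fderiv ℝ F (a, b) ((0 : EuclideanSpace ℝ (Fin n)), EuclideanSpace.single j 1) i).det ≠ 0)
    (hcont : ContinuousAt (fun p => Matrix.of fun (i j : Fin m) =>
      fderiv ℝ F p ((0 : EuclideanSpace ℝ (Fin n)), EuclideanSpace.single j 1) i) (a, b)) :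
    ∃ (X : Set (EuclideanSpace ℝ (Fin n))) (Y : Set (EuclideanSpace ℝ (Fin m))),
      IsOpen X ∧ IsOpen Y ∧ a ∈ X ∧ b ∈ Y ∧ X ×ˢ Y ⊆ Ω ∧
      ∃ g : EuclideanSpace ℝ (Fin n) → EuclideanSpace ℝ (Fin m),
        (∀ x ∈ X, g x ∈ Y) ∧ (∀ x ∈ X, F (x, g x) = 0) ∧ g a = b ∧
        ∀ h : EuclideanSpace ℝ (Fin n) → EuclideanSpace ℝ (Fin m),
          (∀ x ∈ X, h x ∈ Y) → (∀ x ∈ X, F (x, h x) = 0) → Set.EqOn h g X := by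
  classical
  set M : EuclideanSpace ℝ (Fin n) × EuclideanSpace ℝ (Fin m) → Matrix (Fin m) (Fin m) ℝ :=
    fun p => Matrix.of fun (i j : Fin m) =>
      fderiv ℝ F p ((0 : EuclideanSpace ℝ (Fin n)), EuclideanSpace.single j 1) i with hM
  let Φ := Matrix.toEuclideanCLM (n := Fin m) (𝕜 := ℝ)
  have hΦ : Continuous Φ :=
    LinearMap.continuous_of_finiteDimensional (Φ.toAlgEquiv.toLinearEquiv.toLinearMap)
  let L : EuclideanSpace ℝ (Fin n) × EuclideanSpace ℝ (Fin m) →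
      (EuclideanSpace ℝ (Fin m) →L[ℝ] EuclideanSpace ℝ (Fin m)) :=
    fun p => (fderiv ℝ F p).comp (ContinuousLinearMap.inr ℝ _ _)
  have hL : ∀ p, Φ (M p) = L p := by
    intro p
    apply ContinuousLinearMap.coe_injective
    refine (EuclideanSpace.basisFun (Fin m) ℝ).toBasis.ext fun j => ?_
    ext i
    simp [Φ, L, hM, Matrix.ofLp_toEuclideanCLM]
  have hLc : ContinuousAt L (a, b) := by
    have h : ContinuousAt (fun p => Φ (M p)) (a, b) := hΦ.continuousAt.comp hcont
    exact h.congr (Filter.Eventually.of_forall hL)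
  have hu : IsUnit (L (a, b)) := by
    rw [← hL]
    exact ((Matrix.isUnit_iff_isUnit_det _).2 (isUnit_iff_ne_zero.2 hdet)).map Φ
  obtain ⟨u, hu⟩ := hu
  let A := ContinuousLinearEquiv.ofUnit u
  have hA : (A : EuclideanSpace ℝ (Fin m) →L[ℝ] EuclideanSpace ℝ (Fin m)) = L (a, b) := by
    rw [← hu]; rfl
  obtain ⟨c, κ, hκ, hc, hcκ⟩ : ∃ (c : NNReal) (κ : ℝ), 0 < c ∧
      (Subsingleton (EuclideanSpace ℝ (Fin m)) ∨
        c < ‖(A.symm : EuclideanSpace ℝ (Fin m) →L[ℝ] EuclideanSpace ℝ (Fin m))‖₊⁻¹) ∧ 0 < κ ∧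
      (Subsingleton (EuclideanSpace ℝ (Fin m)) ∨ κ ≤
        ((A.toNonlinearRightInverse.nnnorm : ℝ)⁻¹ - c)) := by
    rcases A.subsingleton_or_nnnorm_symm_pos with h | h
    · exact ⟨1, 1, one_pos, Or.inl h, one_pos, Or.inl h⟩
    · have h1 := inv_pos.2 h
      have h2 := NNReal.half_lt_self h1.ne'
      refine ⟨_, _, half_pos h1, Or.inr h2, sub_pos.2 (NNReal.coe_lt_coe.2 h2), Or.inr ?_⟩
      exact le_of_eq (by rw [NNReal.coe_inv]; rfl)
  have hev : ∀ᶠ p in nhds (a, b), p ∈ Ω ∧ ‖L p - L (a, b)‖ ≤ c := by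
    refine Filter.Eventually.and (hΩ.mem_nhds hab) ?_
    have := hLc.eventually (Metric.closedBall_mem_nhds _ (NNReal.coe_pos.2 hκ))
    filter_upwards [this] with p hp
    simpa [dist_eq_norm] using hp
  obtain ⟨δ, hδ, hball⟩ := Metric.eventually_nhds_iff_ball.1 hev
  have hF0 : ∀ᶠ x in nhds a, ‖F (x, b)‖ < κ * (δ / 2) := by
    have h1 : ContinuousAt (fun x => ‖F (x, b)‖) a := by
      have : ContinuousAt (fun x : EuclideanSpace ℝ (Fin n) => F (x, b)) a :=
        ContinuousAt.comp (f := fun x => (x, b)) (g := F) (hF _ hab).continuousAt (by fun_prop)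
      exact this.norm
    refine h1.eventually_lt continuousAt_const ?_
    simp only [hFab, norm_zero]
    exact mul_pos hcκ.1 (half_pos hδ)
  obtain ⟨η, hη, hηb⟩ := Metric.eventually_nhds_iff_ball.1 hF0
  have hsub : ∀ x ∈ Metric.ball a (min δ η), ∀ y ∈ Metric.ball b δ,
      (x, y) ∈ Metric.ball (a, b) δ := by
    intro x hx y hy
    rw [← ball_prod_same]
    exact ⟨Metric.ball_subset_ball (min_le_left _ _) hx, hy⟩
  have happ : ∀ x ∈ Metric.ball a (min δ η), ApproximatesLinearOn (fun y => F (x, y))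
      (A : EuclideanSpace ℝ (Fin m) →L[ℝ] EuclideanSpace ℝ (Fin m)) (Metric.ball b δ) c := by
    intro x hx y hy z hz
    refine (convex_ball b δ).norm_image_sub_le_of_norm_hasFDerivWithin_le'
      (f := fun y => F (x, y)) (f' := fun y => L (x, y)) ?_ ?_ hz hy
    · intro w hw
      have h1 := (hF _ (hball _ (hsub x hx w hw)).1).hasFDerivAt
      exact (h1.comp w (hasFDerivAt_prodMk_right x w)).hasFDerivWithinAt
    · intro w hw
      rw [hA]
      exact (hball _ (hsub x hx w hw)).2
  have hex : ∀ x ∈ Metric.ball a (min δ η), ∃ y ∈ Metric.ball b δ, F (x, y) = 0 := by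
    intro x hx
    rcases hcκ.2 with h | h
    · exact ⟨b, Metric.mem_ball_self hδ, Subsingleton.elim _ _⟩
    · have hcl : Metric.closedBall b (δ / 2) ⊆ Metric.ball b δ :=
        Metric.closedBall_subset_ball (by linarith)
      have hs := (happ x hx).surjOn_closedBall_of_nonlinearRightInverse
        A.toNonlinearRightInverse (by positivity : 0 ≤ δ / 2) hcl
      have h0 := hηb x (Metric.ball_subset_ball (min_le_right _ _) hx)
      obtain ⟨y, hy, hy0⟩ := hs (a := 0) (by
        rw [Metric.mem_closedBall, dist_zero_left]
        exact h0.le.trans (mul_le_mul_of_nonneg_right h (by positivity)))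
      exact ⟨y, hcl hy, hy0⟩
  have hinj : ∀ x ∈ Metric.ball a (min δ η), ∀ y ∈ Metric.ball b δ, ∀ z ∈ Metric.ball b δ,
      F (x, y) = 0 → F (x, z) = 0 → y = z := fun x hx y hy z hz h1 h2 =>
    (happ x hx).injOn hc hy hz (h1.trans h2.symm)
  have ha : a ∈ Metric.ball a (min δ η) := Metric.mem_ball_self (lt_min hδ hη)
  choose! g hgY hg0 using hex
  refine ⟨Metric.ball a (min δ η), Metric.ball b δ, Metric.isOpen_ball, Metric.isOpen_ball, ha,
    Metric.mem_ball_self hδ, ?_, g, hgY, hg0, ?_, ?_⟩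
  · rintro ⟨x, y⟩ ⟨hx, hy⟩
    exact (hball _ (hsub x hx y hy)).1
  · exact hinj a ha _ (hgY a ha) _ (Metric.mem_ball_self hδ) (hg0 a ha) hFab
  · intro h hhY hh0 x hx
    exact hinj x hx _ (hhY x hx) _ (hgY x hx) (hh0 x hx) (hg0 x hx)
end

section
/- (Implicit Function Theorem, differentiability and derivative formula.) Let Ω be an open subset of ℝⁿ × ℝᵐ, let F : Ω → ℝᵐ be differentiable, and let (a, b) ∈ Ω satisfy F(a, b) = 0 and det (∂F/∂y)(a, b) ≠ 0, with (x, y) ↦ (∂F/∂y)(x, y) continuous at (a, b). Then the implicit function g : X → Y (satisfying g(a) = b and F(x, g(x)) = 0 for all x in X, on a suitable open set X × Y ⊆ Ω containing (a, b)) can be chosen so that, in addition, g is differentiable on X and its Jacobian satisfies Jg(x) = − [(∂F/∂y)(x, g(x))]⁻¹ · [(∂F/∂x)(x, g(x))] for all x ∈ X; in particular (∂F/∂y)(x, g(x)) is invertible for all x ∈ X. -/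
open Filter Metric Set Topology Asymptotics in
theorem ift_deriv_aux {E G : Type*} [NormedAddCommGroup E] [NormedSpace ℝ E]
    [NormedAddCommGroup G] [NormedSpace ℝ G] {F : E × G → G} {F' : E × G →L[ℝ] G}
    {g : E → G} {x : E} (B : G ≃L[ℝ] G) (hF : HasFDerivAt F F' (x, g x))
    (hB : ∀ v, F' (0, v) = B v)
    (hO : (fun x' => g x' - g x) =O[𝓝 x] fun x' => x' - x)
    (h0 : ∀ᶠ x' in 𝓝 x, F (x', g x') = 0) :
    HasFDerivAt g (-((B.symm : G →L[ℝ] G).comp (F'.comp (ContinuousLinearMap.inl ℝ E G)))) x := by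
  have hx0 : F (x, g x) = 0 := h0.self_of_nhds
  have hsub : Tendsto (fun x' : E => x' - x) (𝓝 x) (𝓝 0) := by
    have : ContinuousAt (fun x' : E => x' - x) x := by fun_prop
    simpa [ContinuousAt] using this
  have hg : Tendsto g (𝓝 x) (𝓝 (g x)) := by
    have h1 := hO.trans_tendsto hsub
    have h2 := h1.add_const (g x)
    simpa using h2
  have ht : Tendsto (fun x' => (x', g x')) (𝓝 x) (𝓝 (x, g x)) := by
    rw [nhds_prod_eq]
    exact tendsto_id.prodMk hg
  have h1 := (hasFDerivAt_iff_isLittleO.1 hF).comp_tendsto ht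
  have h2 : (fun x' => (x', g x') - (x, g x)) =O[𝓝 x] fun x' => x' - x :=
    (isBigO_refl _ _).prod_left hO
  have h3 := h1.trans_isBigO h2
  have h4 := ((B.symm : G →L[ℝ] G).isBigO_comp _ (𝓝 x)).trans_isLittleO h3
  rw [hasFDerivAt_iff_isLittleO]
  refine (h4.neg_left).congr' ?_ EventuallyEq.rfl
  filter_upwards [h0] with x' hx'
  have h5 : F' (x' - x, g x' - g x) = F' (x' - x, 0) + B (g x' - g x) := by
    rw [← hB, ← map_add]; simp
  simp only [Function.comp, hx', hx0, Prod.mk_sub_mk, h5]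
  simp
  abel

open Filter Metric Set Topology Asymptotics in
theorem ift_aux {E G : Type*} [NormedAddCommGroup E] [NormedSpace ℝ E]
    [NormedAddCommGroup G] [NormedSpace ℝ G] [CompleteSpace G]
    (F : E × G → G) (F' : E × G → E × G →L[ℝ] G) (a : E) (b : G)
    (P : E × G → Prop) (hP : ∀ᶠ p in 𝓝 (a, b), P p)
    (hF : ∀ᶠ p in 𝓝 (a, b), HasFDerivAt F (F' p) p) (hFab : F (a, b) = 0)
    (A : G ≃L[ℝ] G)
    (hA : Tendsto (fun p => (F' p).comp (ContinuousLinearMap.inr ℝ E G)) (𝓝 (a, b))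
      (𝓝 (A : G →L[ℝ] G)))
    (hinv : ∀ᶠ p in 𝓝 (a, b), ∃ B : G ≃L[ℝ] G, ∀ v, F' p (0, v) = B v) :
    ∃ (X : Set E) (Y : Set G), IsOpen X ∧ IsOpen Y ∧ a ∈ X ∧ b ∈ Y ∧
      (∀ p ∈ X ×ˢ Y, P p) ∧ ∃ g : E → G, (∀ x ∈ X, g x ∈ Y) ∧ (∀ x ∈ X, F (x, g x) = 0) ∧
        g a = b ∧ ∀ x ∈ X, ∃ L : E →L[ℝ] G, HasFDerivAt g L x ∧
          ∀ u, F' (x, g x) (0, L u) = - F' (x, g x) (u, 0) := by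
  set K : ℝ := ‖(A.symm : G →L[ℝ] G)‖ + 1 with hKdef
  have hK : 0 < K := by positivity
  have hKA : ∀ v, ‖A.symm v‖ ≤ K * ‖v‖ := fun v => by
    refine ((A.symm : G →L[ℝ] G).le_opNorm v).trans ?_
    gcongr
    linarith
  have hc : 0 < K⁻¹ / 2 := by positivity
  have hnear : ∀ᶠ p in 𝓝 (a, b),
      ‖(F' p).comp (ContinuousLinearMap.inr ℝ E G) - (A : G →L[ℝ] G)‖ ≤ K⁻¹ / 2 := by
    filter_upwards [hA (closedBall_mem_nhds _ hc)] with p hp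
    simpa [dist_eq_norm] using hp
  obtain ⟨ε, hε, hball⟩ := Metric.eventually_nhds_iff_ball.1
    (hP.and (hF.and (hinv.and hnear)))
  have hmem : ∀ x ∈ ball a ε, ∀ y ∈ ball b ε, (x, y) ∈ ball (a, b) ε := by
    intro x hx y hy
    rw [← ball_prod_same]
    exact ⟨hx, hy⟩
  have happ : ∀ x ∈ ball a ε, ApproximatesLinearOn (fun y => F (x, y)) (A : G →L[ℝ] G)
      (ball b ε) ⟨K⁻¹ / 2, hc.le⟩ := by
    intro x hx y hy y' hy'
    change ‖F (x, y) - F (x, y') - (A : G →L[ℝ] G) (y - y')‖ ≤ K⁻¹ / 2 * ‖y - y'‖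
    refine (convex_ball b ε).norm_image_sub_le_of_norm_hasFDerivWithin_le' (𝕜 := ℝ)
      (f := fun y => F (x, y)) (f' := fun y => (F' (x, y)).comp (ContinuousLinearMap.inr ℝ E G)) ?_ ?_ hy' hy
    · intro z hz
      have h1 := (hball _ (hmem x hx z hz)).2.1
      exact (h1.comp z (hasFDerivAt_prodMk_right x z)).hasFDerivWithinAt
    · intro z hz
      exact (hball _ (hmem x hx z hz)).2.2.2
  have hanti : ∀ x ∈ ball a ε, ∀ y ∈ ball b ε, ∀ y' ∈ ball b ε,
      ‖y - y'‖ ≤ 2 * K * ‖F (x, y) - F (x, y')‖ := by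
    intro x hx y hy y' hy'
    have h1 : ‖F (x, y) - F (x, y') - A (y - y')‖ ≤ K⁻¹ / 2 * ‖y - y'‖ := happ x hx y hy y' hy'
    have h2 := hKA (A (y - y'))
    rw [A.symm_apply_apply] at h2
    have h3 : ‖A (y - y')‖ ≤ ‖F (x, y) - F (x, y')‖ + K⁻¹ / 2 * ‖y - y'‖ := by
      have := norm_sub_norm_le (A (y - y')) (F (x, y) - F (x, y'))
      rw [norm_sub_rev (A (y - y'))] at this
      linarith
    have h4 : ‖y - y'‖ ≤ K * (‖F (x, y) - F (x, y')‖ + K⁻¹ / 2 * ‖y - y'‖) :=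
      h2.trans (by gcongr)
    have h5 : K * (K⁻¹ / 2 * ‖y - y'‖) = ‖y - y'‖ / 2 := by field_simp
    rw [mul_add, h5] at h4
    linarith
  let R : (A : G →L[ℝ] G).NonlinearRightInverse :=
    { toFun := A.symm
      nnnorm := ⟨K, hK.le⟩
      bound' := hKA
      right_inv' := fun v => A.apply_symm_apply v }
  have hsurj : ∀ x ∈ ball a ε, SurjOn (fun y => F (x, y)) (closedBall b (ε / 2))
      (closedBall (F (x, b)) ((K⁻¹ - K⁻¹ / 2) * (ε / 2))) := fun x hx =>
    (happ x hx).surjOn_closedBall_of_nonlinearRightInverse R (by positivity)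
      (closedBall_subset_ball (by linarith))
  have hcont : Tendsto (fun x => F (x, b)) (𝓝 a) (𝓝 0) := by
    have h1 : ContinuousAt F (a, b) :=
      ((hball _ (mem_ball_self hε)).2.1).continuousAt
    have h2 : ContinuousAt (fun x => F (x, b)) a :=
      ContinuousAt.comp (f := fun x => (x, b)) h1 (by fun_prop)
    simpa [ContinuousAt, hFab] using h2
  have hρ : 0 < (K⁻¹ - K⁻¹ / 2) * (ε / 2) := by
    have : K⁻¹ - K⁻¹ / 2 = K⁻¹ / 2 := by ring
    rw [this]; positivity
  obtain ⟨δ, hδ, hδb⟩ := Metric.eventually_nhds_iff_ball.1 (hcont (closedBall_mem_nhds _ hρ))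
  have hXε : ∀ x ∈ ball a (min δ ε), x ∈ ball a ε := fun x hx =>
    ball_subset_ball (min_le_right _ _) hx
  have hex : ∀ x, ∃ y, x ∈ ball a (min δ ε) → y ∈ ball b ε ∧ F (x, y) = 0 := by
    intro x
    by_cases hx : x ∈ ball a (min δ ε)
    · have h1 := hδb x (ball_subset_ball (min_le_left _ _) hx)
      obtain ⟨y, hy, hy0⟩ := hsurj x (hXε x hx) (a := 0) (by
        rw [mem_closedBall, dist_comm]; exact h1)
      exact ⟨y, fun _ => ⟨closedBall_subset_ball (by linarith) hy, hy0⟩⟩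
    · exact ⟨b, fun h => absurd h hx⟩
  choose g hg using hex
  have haX : a ∈ ball a (min δ ε) := mem_ball_self (lt_min hδ hε)
  refine ⟨ball a (min δ ε), ball b ε, isOpen_ball, isOpen_ball, haX, mem_ball_self hε, ?_, g,
    fun x hx => (hg x hx).1, fun x hx => (hg x hx).2, ?_, ?_⟩
  · rintro ⟨x, y⟩ ⟨hx, hy⟩
    exact (hball _ (hmem x (hXε x hx) y hy)).1
  · have h1 := hanti a (hXε a haX) (g a) (hg a haX).1 b (mem_ball_self hε)
    rw [(hg a haX).2, hFab] at h1
    simpa [sub_eq_zero] using h1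
  · intro x hx
    obtain ⟨-, hFd, ⟨B, hB⟩, -⟩ := hball _ (hmem x (hXε x hx) (g x) (hg x hx).1)
    have hev : ∀ᶠ x' in 𝓝 x, x' ∈ ball a (min δ ε) := isOpen_ball.mem_nhds hx
    have hO : (fun x' => g x' - g x) =O[𝓝 x] fun x' => x' - x := by
      have h1 : HasFDerivAt (fun x' => F (x', g x)) _ x :=
        hFd.comp x (hasFDerivAt_prodMk_left x (g x))
      refine IsBigO.trans (IsBigO.of_bound (2 * K) ?_) h1.isBigO_sub
      filter_upwards [hev] with x' hx'
      have h2 := hanti x' (hXε x' hx') (g x') (hg x' hx').1 (g x) (hg x hx).1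
      rw [(hg x' hx').2] at h2
      rw [(hg x hx).2]
      simpa using h2
    refine ⟨_, ift_deriv_aux B hFd hB hO (hev.mono fun x' hx' => (hg x' hx').2), fun u => ?_⟩
    rw [hB]
    simp

/-- The Implicit Function Theorem (differentiability and the derivative formula): under the
hypotheses of the implicit function theorem with `∂F/∂y` continuous only at the base point,
the implicit function `g` can be chosen differentiable on `X`, with `(∂F/∂y)(x, g x)`
invertible and `Jg(x) = - [(∂F/∂y)(x, g x)]⁻¹ * [(∂F/∂x)(x, g x)]` for all `x ∈ X`. -/
theorem stmt_10 (n m : ℕ)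
    (Ω : Set (EuclideanSpace ℝ (Fin n) × EuclideanSpace ℝ (Fin m))) (hΩ : IsOpen Ω)
    (F : EuclideanSpace ℝ (Fin n) × EuclideanSpace ℝ (Fin m) → EuclideanSpace ℝ (Fin m))
    (hF : ∀ p ∈ Ω, DifferentiableAt ℝ F p)
    (a : EuclideanSpace ℝ (Fin n)) (b : EuclideanSpace ℝ (Fin m))
    (hab : (a, b) ∈ Ω) (hFab : F (a, b) = 0)
    (hdet : (Matrix.of fun (i j : Fin m) =>
      fderiv ℝ F (a, b) ((0 : EuclideanSpace ℝ (Fin n)), EuclideanSpace.single j 1) i).det ≠ 0)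
    (hcont : ContinuousAt (fun p => Matrix.of fun (i j : Fin m) =>
      fderiv ℝ F p ((0 : EuclideanSpace ℝ (Fin n)), EuclideanSpace.single j 1) i) (a, b)) :
    ∃ (X : Set (EuclideanSpace ℝ (Fin n))) (Y : Set (EuclideanSpace ℝ (Fin m))),
      IsOpen X ∧ IsOpen Y ∧ a ∈ X ∧ b ∈ Y ∧ X ×ˢ Y ⊆ Ω ∧
      ∃ g : EuclideanSpace ℝ (Fin n) → EuclideanSpace ℝ (Fin m),
        (∀ x ∈ X, g x ∈ Y) ∧ (∀ x ∈ X, F (x, g x) = 0) ∧ g a = b ∧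
        (∀ x ∈ X, DifferentiableAt ℝ g x) ∧
        ∀ x ∈ X,
          IsUnit (Matrix.of fun (i j : Fin m) =>
            fderiv ℝ F (x, g x)
              ((0 : EuclideanSpace ℝ (Fin n)), EuclideanSpace.single j 1) i) ∧
          (Matrix.of fun (i : Fin m) (k : Fin n) =>
              fderiv ℝ g x (EuclideanSpace.single k 1) i) =
            - (Matrix.of fun (i j : Fin m) =>
                fderiv ℝ F (x, g x)
                  ((0 : EuclideanSpace ℝ (Fin n)), EuclideanSpace.single j 1) i)⁻¹ *
              (Matrix.of fun (i : Fin m) (k : Fin n) =>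
                fderiv ℝ F (x, g x)
                  (EuclideanSpace.single k 1, (0 : EuclideanSpace ℝ (Fin m)))
                  i) := by
  classical
  set M : EuclideanSpace ℝ (Fin n) × EuclideanSpace ℝ (Fin m) → Matrix (Fin m) (Fin m) ℝ :=
    fun p => Matrix.of fun (i j : Fin m) =>
      fderiv ℝ F p ((0 : EuclideanSpace ℝ (Fin n)), EuclideanSpace.single j 1) i with hM
  have hsum : ∀ v : EuclideanSpace ℝ (Fin m), v = ∑ j, v j • EuclideanSpace.single j (1 : ℝ) := by
    intro v
    ext i
    simp [Pi.single_apply]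
  have key : ∀ p v i, fderiv ℝ F p ((0 : EuclideanSpace ℝ (Fin n)), v) i =
      ∑ j, M p i j * v j := by
    intro p v i
    have h1 : fderiv ℝ F p ((0 : EuclideanSpace ℝ (Fin n)), v) =
        ((fderiv ℝ F p).comp (ContinuousLinearMap.inr ℝ _ _)) v := by simp
    rw [h1]
    conv_lhs => rw [hsum v]
    rw [map_sum]
    simp [hM, mul_comm]
  have hMclm : ∀ p, (fderiv ℝ F p).comp (ContinuousLinearMap.inr ℝ _ _) =
      Matrix.toEuclideanCLM (n := Fin m) (𝕜 := ℝ) (M p) := by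
    intro p
    ext v i
    simp [key, Matrix.mulVec, dotProduct]
  have hequiv : ∀ p, IsUnit (M p) →
      ∃ B : EuclideanSpace ℝ (Fin m) ≃L[ℝ] EuclideanSpace ℝ (Fin m),
        (B : EuclideanSpace ℝ (Fin m) →L[ℝ] EuclideanSpace ℝ (Fin m)) =
          (fderiv ℝ F p).comp (ContinuousLinearMap.inr ℝ _ _) := by
    intro p hp
    obtain ⟨u, hu⟩ := hp.map (Matrix.toEuclideanCLM (n := Fin m) (𝕜 := ℝ))
    refine ⟨ContinuousLinearEquiv.unitsEquiv ℝ _ u, ?_⟩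
    rw [hMclm, ← hu]
    ext v i
    simp
  have hu0 : IsUnit (M (a, b)) := (Matrix.isUnit_iff_isUnit_det _).2 (isUnit_iff_ne_zero.2 hdet)
  have huev : ∀ᶠ p in nhds (a, b), IsUnit (M p) := by
    have h1 : ContinuousAt (fun p => (M p).det) (a, b) :=
      ContinuousAt.comp (g := Matrix.det) (Continuous.matrix_det continuous_id).continuousAt hcont
    filter_upwards [h1.eventually_ne hdet] with p hp
    exact (Matrix.isUnit_iff_isUnit_det _).2 (isUnit_iff_ne_zero.2 hp)
  have hΩev : ∀ᶠ p in nhds (a, b), p ∈ Ω := hΩ.mem_nhds hab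
  obtain ⟨A, hA⟩ := hequiv _ hu0
  obtain ⟨X, Y, hX, hY, haX, hbY, hXY, g, hgY, hg0, hga, hgd⟩ :=
    ift_aux F (fderiv ℝ F) a b (fun p => p ∈ Ω ∧ IsUnit (M p)) (hΩev.and huev)
      (hΩev.mono fun p hp => (hF p hp).hasFDerivAt) hFab A (by
        rw [hA]
        simp only [hMclm]
        have hc : Continuous (Matrix.toEuclideanCLM (n := Fin m) (𝕜 := ℝ)) :=
          LinearMap.continuous_of_finiteDimensional
            (Matrix.toEuclideanCLM (n := Fin m) (𝕜 := ℝ)).toAlgEquiv.toLinearMap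
        exact (hc.tendsto _).comp hcont) (huev.mono fun p hp => by
        obtain ⟨B, hB⟩ := hequiv p hp
        refine ⟨B, fun v => ?_⟩
        have := congrArg (fun T => T v) hB
        simpa using this.symm)
  refine ⟨X, Y, hX, hY, haX, hbY, fun p hp => (hXY p hp).1, g, hgY, hg0, hga, ?_, ?_⟩
  · intro x hx
    obtain ⟨L, hL, -⟩ := hgd x hx
    exact hL.differentiableAt
  · intro x hx
    obtain ⟨L, hL, hL2⟩ := hgd x hx
    have hu : IsUnit (M (x, g x)) := (hXY (x, g x) ⟨hx, hgY x hx⟩).2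
    refine ⟨hu, ?_⟩
    rw [hL.fderiv]
    have hMx : (Matrix.of fun (i j : Fin m) => fderiv ℝ F (x, g x)
        ((0 : EuclideanSpace ℝ (Fin n)), EuclideanSpace.single j 1) i) = M (x, g x) := rfl
    rw [hMx]
    have hdet' : IsUnit (M (x, g x)).det := (Matrix.isUnit_iff_isUnit_det _).1 hu
    have hmul : M (x, g x) * (Matrix.of fun (i : Fin m) (k : Fin n) =>
        L (EuclideanSpace.single k 1) i) = - (Matrix.of fun (i : Fin m) (k : Fin n) =>
                fderiv ℝ F (x, g x)
                  (EuclideanSpace.single k 1, (0 : EuclideanSpace ℝ (Fin m))) i) := by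
      ext i k
      have h1 := congrArg (fun w => w i) (hL2 (EuclideanSpace.single k 1))
      simp only [key] at h1
      simpa [Matrix.mul_apply] using h1
    rw [Matrix.neg_mul, ← Matrix.mul_neg, ← hmul, Matrix.nonsing_inv_mul_cancel_left _ _ hdet']
end

section
/- (Inverse Function Theorem with Jacobian continuous only at the base point.) Let Ω be an open subset of ℝⁿ, let F : Ω → ℝⁿ be differentiable, and let x₀ ∈ Ω be such that the Jacobian matrix JF(x₀) is invertible and the matrix-valued map x ↦ JF(x) is continuous at x₀. Then there exist an open set X ⊆ Ω containing x₀, an open set Y ⊆ ℝⁿ containing y₀ = F(x₀), and a differentiable function G : Y → X such that F(G(y)) = y for all y ∈ Y and G(F(x)) = x for all x ∈ X. -/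
/-- The Inverse Function Theorem with the Jacobian continuous only at the base point:
if `F : Ω → ℝⁿ` is differentiable on the open set `Ω`, `JF(x₀)` is invertible, and
`x ↦ JF(x)` is continuous at `x₀`, then there are open sets `X ∋ x₀`, `Y ∋ F(x₀)` and a
differentiable `G : Y → X` with `F (G y) = y` on `Y` and `G (F x) = x` on `X`. -/
theorem stmt_12 (n : ℕ) (Ω : Set (EuclideanSpace ℝ (Fin n))) (hΩ : IsOpen Ω)
    (F : EuclideanSpace ℝ (Fin n) → EuclideanSpace ℝ (Fin n))
    (hF : ∀ x ∈ Ω, DifferentiableAt ℝ F x)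
    (x₀ : EuclideanSpace ℝ (Fin n)) (hx₀ : x₀ ∈ Ω)
    (hinv : IsUnit (Matrix.of fun (i j : Fin n) =>
      fderiv ℝ F x₀ (EuclideanSpace.single j 1) i))
    (hcont : ContinuousAt (fun x => Matrix.of fun (i j : Fin n) =>
      fderiv ℝ F x (EuclideanSpace.single j 1) i) x₀) :
    ∃ (X Y : Set (EuclideanSpace ℝ (Fin n))),
      IsOpen X ∧ X ⊆ Ω ∧ x₀ ∈ X ∧ IsOpen Y ∧ F x₀ ∈ Y ∧
      ∃ G : EuclideanSpace ℝ (Fin n) → EuclideanSpace ℝ (Fin n),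
        (∀ y ∈ Y, G y ∈ X) ∧ (∀ y ∈ Y, DifferentiableAt ℝ G y) ∧
        (∀ y ∈ Y, F (G y) = y) ∧ (∀ x ∈ X, G (F x) = x) := by
  have key : ∀ x, Matrix.toEuclideanCLM (n := Fin n) (𝕜 := ℝ) (Matrix.of fun (i j : Fin n) =>
      fderiv ℝ F x (EuclideanSpace.single j 1) i) = fderiv ℝ F x := by
    intro x
    apply ContinuousLinearMap.coe_injective
    apply (EuclideanSpace.basisFun (Fin n) ℝ).toBasis.ext
    intro j
    ext i
    simp [Matrix.ofLp_toEuclideanCLM]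
  have hunit : IsUnit (fderiv ℝ F x₀) := by
    rw [← key x₀]
    exact hinv.map (Matrix.toEuclideanCLM (n := Fin n) (𝕜 := ℝ))
  have hlin : Continuous (fun M : Matrix (Fin n) (Fin n) ℝ =>
      Matrix.toEuclideanCLM (n := Fin n) (𝕜 := ℝ) M) :=
    LinearMap.continuous_of_finiteDimensional
      ((Matrix.toEuclideanCLM (n := Fin n) (𝕜 := ℝ)).toAlgEquiv.toLinearMap)
  have hc : ContinuousAt (fderiv ℝ F) x₀ := by
    have h := hlin.continuousAt.comp hcont
    exact h.congr (Filter.Eventually.of_forall key)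
  obtain ⟨u, hu⟩ := hunit
  have hstrict : HasStrictFDerivAt F (fderiv ℝ F x₀) x₀ :=
    hasStrictFDerivAt_of_hasFDerivAt_of_continuousAt
      (Filter.eventually_of_mem (hΩ.mem_nhds hx₀) fun x hx => (hF x hx).hasFDerivAt) hc
  have hstrict' : HasStrictFDerivAt F
      ((ContinuousLinearEquiv.ofUnit u : EuclideanSpace ℝ (Fin n) ≃L[ℝ] EuclideanSpace ℝ (Fin n)) :
        EuclideanSpace ℝ (Fin n) →L[ℝ] EuclideanSpace ℝ (Fin n)) x₀ := by
    rw [← hu] at hstrict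
    exact hstrict
  have hev : ∀ᶠ x in nhds x₀, IsUnit (fderiv ℝ F x) :=
    hc (Units.isOpen.mem_nhds ⟨u, hu⟩)
  obtain ⟨U, hU, hUo, hxU⟩ := eventually_nhds_iff.1 hev
  let e := hstrict'.toOpenPartialHomeomorph F
  have hecoe : ∀ x, e x = F x := fun x => rfl
  have hxe : x₀ ∈ e.source := hstrict'.mem_toOpenPartialHomeomorph_source
  let e' := e.restrOpen (U ∩ Ω) (hUo.inter hΩ)
  have hsrc : e'.source = e.source ∩ (U ∩ Ω) := e.restrOpen_source _ _
  have hx' : x₀ ∈ e'.source := by rw [hsrc]; exact ⟨hxe, hxU, hx₀⟩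
  have hcoe : ∀ x, e' x = F x := fun x => rfl
  refine ⟨e'.source, e'.target, e'.open_source, ?_, hx', e'.open_target, ?_, e'.symm, ?_, ?_, ?_, ?_⟩
  · rw [hsrc]; exact fun x hx => hx.2.2
  · exact e'.map_source hx'
  · exact fun y hy => e'.map_target hy
  · intro y hy
    have hm := e'.map_target hy
    rw [hsrc] at hm
    obtain ⟨v, hv⟩ := hU _ hm.2.1
    have hd := (hF _ hm.2.2).hasFDerivAt
    rw [← hv] at hd
    exact (e'.hasFDerivAt_symm (f' := ContinuousLinearEquiv.ofUnit v) hy hd).differentiableAt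
  · exact fun y hy => e'.right_inv hy
  · exact fun x hx => e'.left_inv hx
end
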